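/- There is no finite non-nilpotent group G all of whose proper subgroups are nilpotent (a Schmidt group) such that φ(S) ≠ 0 for every subgroup S of G and φ(H) divides φ(K) for all subgroups H ⊆ K of G. -/

import Mathlib

/-- For a finite group `G`, `phi G` is the number of elements of `G` whose order
equals the exponent of `G`. -/
noncomputable def phi (G : Type*) [Group G] : ℕ :=
  Nat.card {a : G // orderOf a = Monoid.exponent G}


open Subgroup
open scoped commutatorElement

theorem inf_eq_bot_of_forall_isNilpotent {G : Type*} [Group G] [Finite G]
    [IsSimpleGroup G] (hG : ∀ H : Subgroup G, H ≠ ⊤ → Group.IsNilpotent H) (D : Subgroup G) :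
    ∀ M N : Subgroup G, IsCoatom M → IsCoatom N → M ≠ N → M ⊓ N = D → D = ⊥ := by
  induction D using WellFoundedGT.induction with
  | ind D ih =>
  intro M N hM hN hMN hD
  by_contra hbot
  have hDtop : D ≠ ⊤ := fun h => hM.1 (top_le_iff.1 (h ▸ hD ▸ inf_le_left))
  have hnorm : normalizer (D : Set G) ≠ ⊤ := fun h => by
    have : D.Normal := normalizer_eq_top_iff.1 h
    exact this.eq_bot_or_eq_top.elim hbot hDtop
  obtain ⟨L, hL, hDL⟩ := (eq_top_or_exists_le_coatom (normalizer (D : Set G))).resolve_left hnorm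
  have key : ∀ K : Subgroup G, IsCoatom K → D < K → L = K := by
    intro K hK hDK
    by_contra hne
    have := hG K hK.1
    have hlt : D.subgroupOf K < ⊤ := by
      rw [lt_top_iff_ne_top, Ne, subgroupOf_eq_top]
      exact not_le_of_gt hDK
    have hlt2 := Group.normalizerCondition_of_isNilpotent (G := K) _ hlt
    have hDlt : D < L ⊓ K := by
      obtain ⟨x, hx, hxD⟩ := SetLike.exists_of_lt hlt2
      refine lt_of_le_of_ne (le_inf (le_normalizer.trans hDL) hDK.le) fun h => hxD ?_
      rw [mem_subgroupOf, h]
      refine ⟨hDL ?_, x.2⟩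
      rw [mem_normalizer_iff] at hx ⊢
      intro y
      constructor
      · intro hy
        exact (hx ⟨y, hDK.le hy⟩).1 hy
      · intro hy
        have hyK : y ∈ K := by
          have := K.mul_mem (K.mul_mem (K.inv_mem x.2) (hDK.le hy)) x.2
          simpa [mul_assoc] using this
        exact (hx ⟨y, hyK⟩).2 hy
    exact (hDlt.bot_lt.ne' : L ⊓ K ≠ ⊥) (ih _ hDlt L K hL hK hne rfl)
  have h1 : D < M := lt_of_le_of_ne (hD ▸ inf_le_left) fun h =>
    hMN ((hM.le_iff_eq hN.1).1 (h ▸ hD ▸ inf_le_right)).symm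
  have h2 : D < N := lt_of_le_of_ne (hD ▸ inf_le_right) fun h =>
    hMN ((hN.le_iff_eq hM.1).1 (h ▸ hD ▸ inf_le_left))
  exact hMN ((key M hM h1).symm.trans (key N hN h2))

theorem card_ne_one_add_one (G : Type*) [Group G] [Finite G] :
    Nat.card {g : G // g ≠ 1} + 1 = Nat.card G := by
  have h := Set.ncard_add_ncard_compl ({1} : Set G)
  rw [Set.ncard_singleton, add_comm] at h
  exact h

/-- Conjugation of the nontrivial elements of `M` by coset representatives. It is injective if `M`
is self-normalizing and meets its other conjugates trivially. -/
noncomputable def conjCosets {G : Type*} [Group G] (M : Subgroup G)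
    (z : (G ⧸ M) × {m : M // m ≠ 1}) : {g : G // g ≠ 1} :=
  ⟨z.1.out * z.2.1 * z.1.out⁻¹, by simpa using z.2.2⟩

theorem map_conj_isCoatom {G : Type*} [Group G] {M : Subgroup G} (hM : IsCoatom M) (g : G) :
    IsCoatom (M.map (MulAut.conj g).toMonoidHom) :=
  ((MulAut.conj g).mapSubgroup.isCoatom_iff M).2 hM

theorem isNilpotent_of_isSimpleGroup {G : Type*} [Group G] [Finite G] [IsSimpleGroup G]
    (hG : ∀ H : Subgroup G, H ≠ ⊤ → Group.IsNilpotent H) : Group.IsNilpotent G := by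
  by_contra hnil
  have hcyc : ∀ x : G, zpowers x ≠ ⊤ := fun x hx => hnil <| by
    have : IsCyclic G := isCyclic_iff_exists_zpowers_eq_top.2 ⟨x, hx⟩
    let _ := IsCyclic.commGroup (α := G)
    exact CommGroup.isNilpotent
  have hex : ∀ x : G, ∃ M, IsCoatom M ∧ x ∈ M := fun x => by
    obtain ⟨M, hM, h⟩ := (eq_top_or_exists_le_coatom (zpowers x)).resolve_left (hcyc x)
    exact ⟨M, hM, h (mem_zpowers x)⟩
  have hne : ∀ M : Subgroup G, IsCoatom M → M ≠ ⊥ := by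
    rintro M hM rfl
    obtain ⟨x, hx⟩ := exists_ne (1 : G)
    obtain ⟨N, hN, hxN⟩ := hex x
    have := (hM.le_iff.1 (bot_le : ⊥ ≤ N)).resolve_left hN.1
    exact hx (by simpa [this] using hxN)
  have hself : ∀ M : Subgroup G, IsCoatom M → normalizer (M : Set G) = M := by
    intro M hM
    refine (hM.le_iff.1 le_normalizer).resolve_left fun h => ?_
    have : M.Normal := normalizer_eq_top_iff.1 h
    exact this.eq_bot_or_eq_top.elim (hne M hM) hM.1
  -- a nontrivial element lies in at most one maximal subgroup
  have huniq : ∀ M N : Subgroup G, IsCoatom M → IsCoatom N → ∀ x ∈ M, x ∈ N → x ≠ 1 → M = N := by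
    intro M N hM hN x hx hx' hx1
    by_contra hMN
    have := inf_eq_bot_of_forall_isNilpotent hG _ M N hM hN hMN rfl
    exact hx1 (mem_bot.1 (this ▸ mem_inf.2 ⟨hx, hx'⟩))
  have hconj : ∀ (M N : Subgroup G), IsCoatom M → IsCoatom N → ∀ (a b x y : G), x ∈ M → y ∈ N →
      x ≠ 1 → a * x * a⁻¹ = b * y * b⁻¹ →
      M.map (MulAut.conj a).toMonoidHom = N.map (MulAut.conj b).toMonoidHom := by
    intro M N hM hN a b x y hx hy hx1 h
    refine huniq _ _ (map_conj_isCoatom hM a) (map_conj_isCoatom hN b) (a * x * a⁻¹)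
      ⟨x, hx, rfl⟩ (h ▸ ⟨y, hy, rfl⟩) (by simpa using hx1)
  have hinj : ∀ M : Subgroup G, IsCoatom M → Function.Injective (conjCosets M) := by
    rintro M hM ⟨c, x, hx⟩ ⟨d, y, hy⟩ h
    have h' : c.out * x * c.out⁻¹ = d.out * y * d.out⁻¹ := congrArg Subtype.val h
    have hmap := hconj M M hM hM _ _ x y x.2 y.2 (by simpa using hx) h'
    have hcd : c = d := by
      rw [← c.out_eq', ← d.out_eq']
      refine QuotientGroup.eq.2 ?_
      refine (hself M hM).le ?_
      have : M.map (MulAut.conj (c.out⁻¹ * d.out)).toMonoidHom = M := by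
        have := congrArg (Subgroup.map (MulAut.conj c.out⁻¹).toMonoidHom) hmap
        rw [Subgroup.map_map, Subgroup.map_map] at this
        have e1 : (MulAut.conj c.out⁻¹).toMonoidHom.comp (MulAut.conj c.out).toMonoidHom
            = MonoidHom.id G := by ext; simp [mul_assoc]
        have e2 : (MulAut.conj c.out⁻¹).toMonoidHom.comp (MulAut.conj d.out).toMonoidHom
            = (MulAut.conj (c.out⁻¹ * d.out)).toMonoidHom := by ext; simp [mul_assoc]
        rw [e1, e2, Subgroup.map_id] at this
        exact this.symm
      rw [mem_normalizer_iff]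
      intro z
      refine Iff.trans ?_ (SetLike.ext_iff.1 this _)
      constructor
      · exact fun hz => ⟨z, hz, rfl⟩
      · rintro ⟨w, hw, hwz⟩
        have : w = z := (MulAut.conj (c.out⁻¹ * d.out)).injective hwz
        exact this ▸ hw
    subst hcd
    have : x = y := by simpa using h'
    subst this
    rfl
  have hcard : ∀ M : Subgroup G, Nat.card ((G ⧸ M) × {m : M // m ≠ 1}) + M.index = Nat.card G := by
    intro M
    rw [Nat.card_prod, ← Subgroup.index, ← M.index_mul_card, ← card_ne_one_add_one M]; ring
  have hone := card_ne_one_add_one G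
  obtain ⟨M, hM, -⟩ := hex 1
  have hidx : ∀ M : Subgroup G, IsCoatom M → 1 < M.index ∧ 2 * M.index ≤ Nat.card G := by
    intro M hM
    constructor
    · have := M.index_ne_zero_of_finite
      have := mt Subgroup.index_eq_one.1 hM.1
      omega
    · rw [← M.index_mul_card, mul_comm]
      have := (Subgroup.one_lt_card_iff_ne_bot M).2 (hne M hM)
      gcongr
      omega
  have hnsurj : ¬ Function.Surjective (conjCosets M) := fun hs => by
    have := Nat.card_congr (Equiv.ofBijective _ ⟨hinj M hM, hs⟩)
    have := hcard M
    have := (hidx M hM).1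
    omega
  rw [Function.Surjective] at hnsurj
  push Not at hnsurj
  obtain ⟨x, hx⟩ := hnsurj
  obtain ⟨N, hN, hxN⟩ := hex x
  have hsum : Function.Injective (Sum.elim (conjCosets M) (conjCosets N)) := by
    refine (hinj M hM).sumElim (hinj N hN) ?_
    rintro ⟨c, y, hy⟩ ⟨d, z, hz⟩ h
    have h' : c.out * y * c.out⁻¹ = d.out * z * d.out⁻¹ := congrArg Subtype.val h
    have hmap := hconj M N hM hN _ _ y z y.2 z.2 (by simpa using hy) h'
    have : d.out * x * d.out⁻¹ ∈ M.map (MulAut.conj c.out).toMonoidHom :=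
      hmap ▸ ⟨x, hxN, rfl⟩
    obtain ⟨w, hw, hwx⟩ := this
    set g := d.out⁻¹ * c.out with hg
    have hgx : g * w * g⁻¹ = x := by
      have hwx' : c.out * w * c.out⁻¹ = d.out * x * d.out⁻¹ := hwx
      have : g * w * g⁻¹ = d.out⁻¹ * (c.out * w * c.out⁻¹) * d.out := by simp [hg, mul_assoc]
      rw [this, hwx']; simp [mul_assoc]
    obtain ⟨m, hm⟩ := QuotientGroup.mk_out_eq_mul M g
    have hw1 : w ≠ 1 := by
      rintro rfl
      exact x.2 (by simpa using hgx.symm)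
    refine hx ⟨(g : G ⧸ M), ⟨m⁻¹ * ⟨w, hw⟩ * m, ?_⟩⟩ ?_
    · intro h1
      have h2 : (⟨w, hw⟩ : M) = 1 := by
        have : (⟨w, hw⟩ : M) = m * (m⁻¹ * ⟨w, hw⟩ * m) * m⁻¹ := by group
        rw [this, h1]; simp
      exact hw1 (congrArg Subtype.val h2)
    · apply Subtype.ext
      change (g : G ⧸ M).out * ((m : G)⁻¹ * w * m) * (g : G ⧸ M).out⁻¹ = x
      rw [hm, ← hgx]; group
  have := Nat.card_le_card_of_injective _ hsum
  rw [Nat.card_sum] at this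
  have := hcard M
  have := hcard N
  have := hidx M hM
  have := hidx N hN
  omega

theorem exists_normal_index_prime {G : Type*} [Group G] [Finite G] [Nontrivial G]
    (hG : ∀ H : Subgroup G, H ≠ ⊤ → Group.IsNilpotent H) :
    ∃ N : Subgroup G, N.Normal ∧ N.index.Prime := by
  obtain ⟨N, hN⟩ := (Set.toFinite {N : Subgroup G | N.Normal ∧ N ≠ ⊤}).exists_maximal
    ⟨⊥, inferInstance, bot_ne_top⟩
  have := hN.1.1
  have hnt : Nontrivial (G ⧸ N) := QuotientGroup.nontrivial_iff.2 hN.1.2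
  have hsurj := QuotientGroup.mk'_surjective N
  have : IsSimpleGroup (G ⧸ N) := by
    refine ⟨fun K hK => ?_⟩
    by_cases h : K.comap (QuotientGroup.mk' N) = ⊤
    · right
      rw [← Subgroup.map_comap_eq_self_of_surjective hsurj K, h, Subgroup.map_top_of_surjective _ hsurj]
    · left
      have hle := hN.2 ⟨hK.comap _, h⟩ (QuotientGroup.le_comap_mk' N K)
      rw [← Subgroup.map_comap_eq_self_of_surjective hsurj K, Subgroup.map_eq_bot_iff]
      simpa using hle
  have hnil : Group.IsNilpotent (G ⧸ N) := by
    refine isNilpotent_of_isSimpleGroup fun H hH => ?_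
    have := hG (H.comap (QuotientGroup.mk' N)) fun h => hH (by
      rw [← Subgroup.map_comap_eq_self_of_surjective hsurj H, h, Subgroup.map_top_of_surjective _ hsurj])
    exact Group.nilpotent_of_surjective _
      (MonoidHom.subgroupComap_surjective_of_surjective (QuotientGroup.mk' N) H hsurj)
  exact ⟨N, hN.1.1, IsSimpleGroup.prime_card (α := G ⧸ N)⟩

theorem mem_of_pow_mem_of_coprime {G : Type*} [Group G] {H : Subgroup G} {x : G} {a b : ℕ}
    (hab : a.Coprime b) (ha : x ^ a ∈ H) (hb : x ^ b ∈ H) : x ∈ H := by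
  have h := Nat.gcd_eq_gcd_ab a b
  rw [Nat.Coprime.gcd_eq_one hab] at h
  have : x = (x ^ a) ^ a.gcdA b * (x ^ b) ^ a.gcdB b := by
    rw [← zpow_natCast, ← zpow_natCast, ← zpow_mul, ← zpow_mul, ← zpow_add, ← h]; simp
  rw [this]
  exact H.mul_mem (H.zpow_mem ha _) (H.zpow_mem hb _)

theorem eq_one_of_pow_eq_one_of_coprime {G : Type*} [Group G] {x : G} {a b : ℕ}
    (hab : a.Coprime b) (ha : x ^ a = 1) (hb : x ^ b = 1) : x = 1 :=
  mem_bot.1 (mem_of_pow_mem_of_coprime hab (mem_bot.2 ha) (mem_bot.2 hb))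

theorem isPGroup_zpowers {G : Type*} [Group G] {p k : ℕ} {x : G} (hx : x ^ p ^ k = 1) :
    IsPGroup p (zpowers x) := by
  rintro ⟨_, m, rfl⟩
  refine ⟨k, Subtype.ext ?_⟩
  simp only [SubgroupClass.coe_pow, OneMemClass.coe_one]
  rw [← zpow_natCast, ← zpow_mul, mul_comm, zpow_mul, zpow_natCast, hx, one_zpow]

theorem commute_of_isNilpotent {G : Type*} [Group G] [Finite G] [Group.IsNilpotent G]
    {p q i j : ℕ} (hp : p.Prime) (hq : q.Prime) (hpq : p ≠ q) {a b : G}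
    (ha : a ^ p ^ i = 1) (hb : b ^ q ^ j = 1) : Commute a b := by
  have := Fact.mk hp
  have := Fact.mk hq
  obtain ⟨P, hP⟩ := (isPGroup_zpowers ha).exists_le_sylow
  obtain ⟨Q, hQ⟩ := (isPGroup_zpowers hb).exists_le_sylow
  exact commute_of_normal_of_disjoint P.toSubgroup Q.toSubgroup inferInstance inferInstance
    (IsPGroup.disjoint_of_ne p q hpq _ _ P.2 Q.2) a b (hP (mem_zpowers a)) (hQ (mem_zpowers b))

theorem commute_of_mem_of_isNilpotent {G : Type*} [Group G] [Finite G] {H : Subgroup G}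
    (hH : Group.IsNilpotent H)
    {p q i j : ℕ} (hp : p.Prime) (hq : q.Prime) (hpq : p ≠ q) {a b : G} (haH : a ∈ H) (hbH : b ∈ H)
    (ha : a ^ p ^ i = 1) (hb : b ^ q ^ j = 1) : Commute a b :=
  congrArg Subtype.val (commute_of_isNilpotent hp hq hpq (a := (⟨a, haH⟩ : H)) (b := ⟨b, hbH⟩)
    (Subtype.ext ha) (Subtype.ext hb)).eq

theorem IsPGroup.exists_pow_eq_one {G : Type*} [Group G] {p : ℕ} {P : Subgroup G}
    (hP : IsPGroup p P) {x : G} (hx : x ∈ P) : ∃ k, x ^ p ^ k = 1 :=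
  (hP ⟨x, hx⟩).imp fun _ h => congrArg Subtype.val h

theorem sylow_normal_of_index_prime {G : Type*} [Group G] [Finite G] {N : Subgroup G} [N.Normal]
    [Group.IsNilpotent N] {q r : ℕ} [Fact r.Prime] (hq : q.Prime) (hN : N.index = q) (hr : r ≠ q)
    (R : Sylow r G) : R.Normal := by
  have hr' : r.Prime := Fact.out
  have hle : (R : Subgroup G) ≤ N := fun x hx => by
    obtain ⟨k, hk⟩ := R.2.exists_pow_eq_one hx
    refine mem_of_pow_mem_of_coprime (a := q) (b := r ^ k) ?_ (hN ▸ N.pow_index_mem x)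
      (hk ▸ N.one_mem)
    exact ((Nat.coprime_primes hq hr').2 hr.symm).pow_right k
  have hchar := (R.subtype hle).characteristic_of_normal inferInstance
  have : (((R.subtype hle) : Subgroup N).map N.subtype).Normal := inferInstance
  rwa [Sylow.coe_subtype, subgroupOf_map_subtype, inf_eq_left.2 hle] at this

theorem eq_top_of_forall_sylow_le {G : Type*} [Group G] [Finite G] {H : Subgroup G}
    (h : ∀ r, Fact r.Prime → ∃ R : Sylow r G, (R : Subgroup G) ≤ H) : H = ⊤ := by
  refine Subgroup.eq_top_of_card_eq H (Nat.dvd_antisymm H.card_subgroup_dvd_card ?_)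
  refine (Nat.dvd_iff_prime_pow_dvd_dvd _ _).2 fun r k hr hk => ?_
  have := Fact.mk hr
  obtain ⟨R, hR⟩ := h r this
  exact (R.pow_dvd_card_of_pow_dvd_card hk).trans (card_dvd_of_le hR)

theorem isComplement'_zpowers {G : Type*} [Group G] [Finite G] {p q n : ℕ} (hp : p.Prime)
    (hq : q.Prime) (hpq : p ≠ q) {P : Subgroup G} [P.Normal] (hP : IsPGroup p P) {y : G}
    (hy : y ^ q ^ n = 1) (hPy : P ⊔ zpowers y = ⊤) : IsComplement' P (zpowers y) := by
  have := Fact.mk hp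
  have := Fact.mk hq
  refine isComplement'_of_disjoint_and_mul_eq_univ
    (IsPGroup.disjoint_of_ne p q hpq _ _ hP (isPGroup_zpowers hy)) ?_
  rw [← normal_mul, hPy, coe_top]

/-- A minimal non-nilpotent group is generated by a normal `p`-subgroup and an element of `q`-power
order. -/
theorem exists_sylow_of_minimal_nonnilpotent {G : Type*} [Group G] [Finite G]
    (hnil : ¬ Group.IsNilpotent G) (hG : ∀ H : Subgroup G, H ≠ ⊤ → Group.IsNilpotent H) :
    ∃ p q n : ℕ, ∃ P : Subgroup G, ∃ y : G, p.Prime ∧ q.Prime ∧ p ≠ q ∧ P.Normal ∧ IsPGroup p P ∧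
      orderOf y = q ^ n ∧ P ⊔ zpowers y = ⊤ := by
  have : Nontrivial G := not_subsingleton_iff_nontrivial.1 fun h => hnil inferInstance
  obtain ⟨N, hN, hq⟩ := exists_normal_index_prime hG
  obtain ⟨q, hNq⟩ : ∃ q, N.index = q := ⟨_, rfl⟩
  rw [hNq] at hq
  have hNtop : N ≠ ⊤ := fun h => hq.ne_one (by rw [← hNq, h, index_top])
  have hNnil := hG N hNtop
  have hnormal : ∀ r, Fact r.Prime → r ≠ q → ∀ R : Sylow r G, R.Normal := fun r _ hr R =>
    sylow_normal_of_index_prime hq hNq hr R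
  have hqf := Fact.mk hq
  obtain ⟨Q⟩ : Nonempty (Sylow q G) := inferInstance
  have hQ : ¬ (Q : Subgroup G).Normal := fun h => hnil <| by
    refine ((Group.isNilpotent_of_finite_tfae (G := G)).out 0 3).2 fun r hr R => ?_
    by_cases hrq : r = q
    · subst hrq
      have := Sylow.unique_of_normal Q h
      exact Subsingleton.elim Q R ▸ h
    · exact hnormal r hr hrq R
  obtain ⟨p, hp, hpq, P, hPQ⟩ : ∃ p, ∃ _ : Fact p.Prime, p ≠ q ∧ ∃ P : Sylow p G,
      ¬ (P : Subgroup G) ≤ normalizer ((Q : Subgroup G) : Set G) := by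
    by_contra! h
    refine hQ (normalizer_eq_top_iff.1 (eq_top_of_forall_sylow_le fun r hr => ?_))
    by_cases hrq : r = q
    · subst hrq
      exact ⟨Q, le_normalizer⟩
    · exact ⟨Classical.arbitrary _, h r hr hrq _⟩
  have hPn := hnormal p hp hpq P
  obtain ⟨y, hyQ, hy⟩ : ∃ y ∈ Q, (P : Subgroup G) ⊔ zpowers y = ⊤ := by
    by_contra! h
    refine hPQ fun x hx => ?_
    obtain ⟨i, hi⟩ := P.2.exists_pow_eq_one hx
    refine centralizer_le_normalizer _ fun y hy => ?_
    obtain ⟨j, hj⟩ := Q.2.exists_pow_eq_one hy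
    exact (commute_of_mem_of_isNilpotent (hG _ (h y hy)) hp.out hq hpq
      (mem_sup_left hx) (mem_sup_right (mem_zpowers y)) hi hj).symm
  obtain ⟨j, hj⟩ := Q.2.exists_pow_eq_one hyQ
  obtain ⟨n, -, hn⟩ := (Nat.dvd_prime_pow hq).1 (orderOf_dvd_of_pow_eq_one hj)
  exact ⟨p, q, n, P, y, hp.out, hq, hpq, hPn, P.2, hn, hy⟩

/-- `G` is a minimal non-nilpotent group, generated by a normal `p`-subgroup `P` and an element
`y` of order `q ^ n`. -/
structure IsSchmidt {G : Type*} [Group G] (p q n : ℕ) (P : Subgroup G) (y : G) : Prop where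
  prime_p : p.Prime
  prime_q : q.Prime
  ne : p ≠ q
  normal : P.Normal
  isPGroup : IsPGroup p P
  orderOf_eq : orderOf y = q ^ n
  sup_eq_top : P ⊔ zpowers y = ⊤
  not_isNilpotent : ¬ Group.IsNilpotent G
  isNilpotent_of_ne_top : ∀ H : Subgroup G, H ≠ ⊤ → Group.IsNilpotent H

namespace IsSchmidt

variable {G : Type*} [Group G] {p q n : ℕ} {P : Subgroup G} {y : G}

theorem pow_eq_one (h : IsSchmidt p q n P y) : y ^ q ^ n = 1 := h.orderOf_eq ▸ pow_orderOf_eq_one y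

theorem coprime_pow (h : IsSchmidt p q n P y) (i j : ℕ) : (p ^ i).Coprime (q ^ j) :=
  Nat.Coprime.pow _ _ ((Nat.coprime_primes h.prime_p h.prime_q).2 h.ne)

theorem mem_center_of_commute (h : IsSchmidt p q n P y) {c : G} (hy : Commute c y)
    (hP : ∀ x ∈ P, Commute c x) : c ∈ center G := by
  have : P ⊔ zpowers y ≤ centralizer {c} := by
    refine sup_le (fun x hx => mem_centralizer_singleton_iff.2 (hP x hx).symm.eq)
      (zpowers_le.2 (mem_centralizer_singleton_iff.2 hy.symm.eq))
  rw [h.sup_eq_top] at this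
  exact mem_center_iff.2 fun g => mem_centralizer_singleton_iff.1 (this (mem_top g))

variable [Finite G]

theorem isComplement' (h : IsSchmidt p q n P y) : IsComplement' P (zpowers y) :=
  have := h.normal
  isComplement'_zpowers h.prime_p h.prime_q h.ne h.isPGroup h.pow_eq_one h.sup_eq_top

theorem card_mul (h : IsSchmidt p q n P y) : Nat.card P * q ^ n = Nat.card G := by
  rw [← h.isComplement'.card_mul_card, Nat.card_zpowers, h.orderOf_eq]

theorem index_eq (h : IsSchmidt p q n P y) : P.index = q ^ n := by
  rw [h.isComplement'.symm.index_eq_card, Nat.card_zpowers, h.orderOf_eq]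

theorem of_orderOf_eq (h : IsSchmidt p q n P y) {u : G} (hu : orderOf u = q ^ n) :
    IsSchmidt p q n P u := by
  have := h.normal
  obtain ⟨k, hk⟩ := (have := Fact.mk h.prime_p; IsPGroup.iff_card.1 h.isPGroup)
  have hc : IsComplement' P (zpowers u) := by
    refine isComplement'_of_coprime ?_ ?_ <;> rw [Nat.card_zpowers, hu]
    · exact h.card_mul
    · exact hk ▸ h.coprime_pow k n
  exact { h with orderOf_eq := hu, sup_eq_top := hc.sup_eq_top }

theorem exists_not_commute (h : IsSchmidt p q n P y) : ∃ x ∈ P, ¬ Commute x y := by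
  by_contra! hc
  have := Fact.mk h.prime_p
  have := Fact.mk h.prime_q
  have := h.isPGroup.isNilpotent
  have := (isPGroup_zpowers h.pow_eq_one).isNilpotent
  have hcomm : ∀ (a : P) (b : zpowers y), Commute (P.subtype a) ((zpowers y).subtype b) := by
    rintro ⟨a, ha⟩ ⟨_, k, rfl⟩
    exact (hc a ha).zpow_right k
  refine h.not_isNilpotent (Group.nilpotent_of_surjective
    (MonoidHom.noncommCoprod P.subtype (zpowers y).subtype hcomm) ?_)
  exact h.isComplement'.2

theorem ne_bot (h : IsSchmidt p q n P y) : P ≠ ⊥ := by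
  rintro rfl
  obtain ⟨x, hx, hxy⟩ := h.exists_not_commute
  rw [mem_bot.1 hx] at hxy
  exact hxy (Commute.one_left y)

theorem pos (h : IsSchmidt p q n P y) : 0 < n := by
  rw [Nat.pos_iff_ne_zero]
  rintro rfl
  obtain ⟨x, hx, hxy⟩ := h.exists_not_commute
  have : y = 1 := by simpa using h.orderOf_eq
  exact hxy (this ▸ Commute.one_right x)

theorem commute_of_invariant (h : IsSchmidt p q n P y) {R : Subgroup G} (hRP : R < P)
    (hR : ∀ r ∈ R, y * r * y⁻¹ ∈ R) {r : G} (hr : r ∈ R) : Commute r y := by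
  have hle : zpowers y ≤ normalizer (R : Set G) := zpowers_le.2 (mem_normalizer_fintype hR)
  have hne : R ⊔ zpowers y ≠ ⊤ := by
    intro htop
    have : R.Normal := by
      rw [← normalizer_eq_top_iff, ← top_le_iff, ← htop]
      exact sup_le le_normalizer hle
    have h2 := (isComplement'_zpowers h.prime_p h.prime_q h.ne
      (h.isPGroup.to_le hRP.le) h.pow_eq_one htop).card_mul_card
    rw [← h.isComplement'.card_mul_card] at h2
    have := Nat.eq_of_mul_eq_mul_right Nat.card_pos h2
    exact hRP.ne (Subgroup.eq_of_le_of_card_ge hRP.le this.ge)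
  obtain ⟨i, hi⟩ := h.isPGroup.exists_pow_eq_one (hRP.le hr)
  exact commute_of_mem_of_isNilpotent (h.isNilpotent_of_ne_top _ hne) h.prime_p h.prime_q h.ne
    (mem_sup_left hr) (mem_sup_right (mem_zpowers y)) hi h.pow_eq_one

theorem eq_of_forall_mem (h : IsSchmidt p q n P y) {R : Subgroup G} (hRP : R ≤ P)
    (hR : ∀ x ∈ P, x⁻¹ * (y * x * y⁻¹) ∈ R) : R = P := by
  by_contra hne
  obtain ⟨x, hx, hxy⟩ := h.exists_not_commute
  have hcomm := h.commute_of_invariant (lt_of_le_of_ne hRP hne)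
    (fun r hr => by simpa using R.mul_mem hr (hR r (hRP hr))) (hR x hx)
  set d := x⁻¹ * (y * x * y⁻¹) with hd
  have hk : ∀ k : ℕ, y ^ k * x = x * d ^ k * y ^ k := by
    intro k
    induction k with
    | zero => simp
    | succ k ih =>
      have e1 : y * x = x * d * y := by simp [hd, mul_assoc]
      rw [pow_succ', mul_assoc, ih, pow_succ' d]
      have e2 := (hcomm.pow_left k).eq
      calc y * (x * d ^ k * y ^ k) = (y * x) * d ^ k * y ^ k := by simp only [mul_assoc]
        _ = x * d * (y * d ^ k) * y ^ k := by rw [e1]; simp only [mul_assoc]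
        _ = _ := by rw [← e2]; simp only [mul_assoc]
  have h1 : d ^ q ^ n = 1 := by
    have := hk (q ^ n)
    simpa [h.pow_eq_one] using this
  obtain ⟨i, hi⟩ := h.isPGroup.exists_pow_eq_one (hRP (hR x hx))
  have hd1 : d = 1 := eq_one_of_pow_eq_one_of_coprime (h.coprime_pow i n) hi h1
  have := hk 1
  rw [hd1] at this
  exact hxy (by simpa using this.symm : x * y = y * x)

theorem pow_q_mem_center (h : IsSchmidt p q n P y) : y ^ q ∈ center G := by
  have := h.normal
  refine h.mem_center_of_commute (Commute.pow_self y q) fun x hx => ?_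
  have hpow : (y ^ q) ^ q ^ (n - 1) = 1 := by
    rw [← pow_mul, ← pow_succ', Nat.sub_add_cancel h.pos, h.pow_eq_one]
  have hne : P ⊔ zpowers (y ^ q) ≠ ⊤ := fun htop => by
    have hc := (isComplement'_zpowers h.prime_p h.prime_q h.ne h.isPGroup hpow htop).card_mul_card
    rw [← h.isComplement'.card_mul_card, Nat.card_zpowers, Nat.card_zpowers, h.orderOf_eq] at hc
    have := Nat.eq_of_mul_eq_mul_left Nat.card_pos hc
    have hdvd := orderOf_dvd_of_pow_eq_one hpow
    rw [this, Nat.pow_dvd_pow_iff_le_right h.prime_q.one_lt] at hdvd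
    have := h.pos
    omega
  obtain ⟨i, hi⟩ := h.isPGroup.exists_pow_eq_one hx
  exact (commute_of_mem_of_isNilpotent (h.isNilpotent_of_ne_top _ hne) h.prime_p h.prime_q h.ne
    (mem_sup_left hx) (mem_sup_right (mem_zpowers _)) hi hpow).symm

theorem commutator_lt (h : IsSchmidt p q n P y) : ⁅P, P⁆ < P := by
  have := Fact.mk h.prime_p
  have := h.isPGroup.isNilpotent
  have : Nontrivial P := (nontrivial_iff_ne_bot P).2 h.ne_bot
  have := Group.IsSolvable.commutator_lt_top_of_nontrivial P
  have := (map_subtype_lt_map_subtype (G' := P)).2 this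
  rwa [map_subtype_commutator, ← MonoidHom.range_eq_map, range_subtype] at this

theorem commute_of_mem_commutator (h : IsSchmidt p q n P y) {d : G} (hd : d ∈ ⁅P, P⁆) :
    Commute d y :=
  have := h.normal
  h.commute_of_invariant h.commutator_lt
    (fun r hr => (inferInstance : (⁅P, P⁆ : Subgroup G).Normal).conj_mem r hr y) hd

theorem mem_center (h : IsSchmidt p q n P y) {c : G} (hc : c ∈ P) (hcy : Commute c y) :
    c ∈ center G := by
  have := h.normal
  have hR : P ⊓ centralizer {c} = P := by
    refine h.eq_of_forall_mem inf_le_left fun x hx => ⟨?_, ?_⟩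
    · exact P.mul_mem (P.inv_mem hx) (this.conj_mem x hx y)
    · obtain ⟨d, hd, hdx⟩ : ∃ d ∈ ⁅P, P⁆, c * x * c⁻¹ = d * x :=
        ⟨⁅c, x⁆, commutator_mem_commutator hc hx, by simp [commutatorElement_def]⟩
      have hdy := (h.commute_of_mem_commutator hd).eq
      have hcy' : c * y * c⁻¹ = y := by rw [hcy.eq]; simp
      change _ ∈ centralizer {c}
      rw [mem_centralizer_singleton_iff, eq_comm, ← mul_inv_eq_iff_eq_mul]
      calc c * (x⁻¹ * (y * x * y⁻¹)) * c⁻¹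
          = (c * x * c⁻¹)⁻¹ * (c * y * c⁻¹) * (c * x * c⁻¹) * (c * y * c⁻¹)⁻¹ := by group
        _ = x⁻¹ * d⁻¹ * (y * d) * x * y⁻¹ := by rw [hdx, hcy']; group
        _ = x⁻¹ * (y * x * y⁻¹) := by rw [← hdy]; group
  exact h.mem_center_of_commute hcy fun x hx =>
    (mem_centralizer_singleton_iff.1 (hR.ge hx).2).symm

theorem le_commutator (h : IsSchmidt p q n P y) : P ≤ commutator G := by
  have := h.normal
  have hR : P ⊓ commutator G = P := by
    refine h.eq_of_forall_mem inf_le_left fun x hx => ⟨?_, ?_⟩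
    · exact P.mul_mem (P.inv_mem hx) (this.conj_mem x hx y)
    · have : x⁻¹ * (y * x * y⁻¹) = ⁅x⁻¹, y⁆ := by simp [commutatorElement_def, mul_assoc]
      rw [this]
      exact commutator_mem_commutator (mem_top _) (mem_top _)
  exact inf_eq_left.1 hR

theorem mem_commutator (h : IsSchmidt p q n P y) {c : G} (hc : c ∈ P) (hcz : c ∈ center G) :
    c ∈ ⁅P, P⁆ := by
  have h1 := MonoidHom.transfer_eq_pow (Abelianization.of (G := P)) c fun k g _ => by
    have := mem_center_iff.1 ((center G).pow_mem hcz k) g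
    rw [mul_assoc, ← this]; simp
  rw [show MonoidHom.transfer (Abelianization.of (G := P)) c = 1 from
    Abelianization.commutator_subset_ker _ (h.le_commutator hc), eq_comm, ← MonoidHom.mem_ker,
    Abelianization.ker_of] at h1
  have h2 : c ^ P.index ∈ ⁅P, P⁆ := by
    rw [← map_subtype_commutator]
    exact ⟨_, h1, rfl⟩
  rw [h.index_eq] at h2
  obtain ⟨i, hi⟩ := h.isPGroup.exists_pow_eq_one hc
  exact mem_of_pow_mem_of_coprime (h.coprime_pow i n) (hi ▸ one_mem _) h2

theorem pow_mem_center (h : IsSchmidt p q n P y) {x : G} (hx : x ∈ P) : x ^ p ∈ center G := by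
  have := h.normal
  set R0 : Subgroup P := (powMonoidHom p : Abelianization P →* Abelianization P).range.comap
    Abelianization.of with hR0
  refine h.mem_center (P.pow_mem hx p) ?_
  refine h.commute_of_invariant (R := R0.map P.subtype) (lt_of_le_of_ne (map_subtype_le R0) ?_) ?_
    ⟨⟨x, hx⟩ ^ p, ⟨Abelianization.of ⟨x, hx⟩, (map_pow _ _ _).symm⟩, rfl⟩
  · intro hP
    have htop : R0 = ⊤ := by
      apply map_injective P.subtype_injective
      rw [hP, ← MonoidHom.range_eq_map, range_subtype]
    have hsurj : Function.Surjective fun a : Abelianization P => a ^ p := fun a => by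
      obtain ⟨x, rfl⟩ := QuotientGroup.mk'_surjective _ a
      exact (htop ▸ mem_top x : x ∈ R0)
    have hsurj' : ∀ k : ℕ, Function.Surjective fun a : Abelianization P => a ^ p ^ k := fun k => by
      induction k with
      | zero => exact fun a => ⟨a, by simp⟩
      | succ k ih =>
        have := ih.comp hsurj
        simpa only [Function.comp_def, ← pow_mul, ← pow_succ'] using this
    obtain ⟨k, hk⟩ := (have := Fact.mk h.prime_p; IsPGroup.iff_card.1 h.isPGroup)
    refine h.commutator_lt.ne (le_antisymm h.commutator_lt.le fun z hz => ?_)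
    rw [← map_subtype_commutator]
    refine ⟨⟨z, hz⟩, ?_, rfl⟩
    obtain ⟨a, ha⟩ := hsurj' k (Abelianization.of ⟨z, hz⟩)
    obtain ⟨x, rfl⟩ := QuotientGroup.mk'_surjective _ a
    rw [SetLike.mem_coe, ← Abelianization.ker_of, MonoidHom.mem_ker, ← ha]
    change Abelianization.of x ^ p ^ k = 1
    rw [← map_pow, ← hk, pow_card_eq_one', map_one]
  · rintro _ ⟨r, ⟨b, hb⟩, rfl⟩
    refine ⟨MulAut.conjNormal y r, ⟨Abelianization.map (MulAut.conjNormal y).toMonoidHom b, ?_⟩,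
      by simp⟩
    have := congrArg (Abelianization.map (MulAut.conjNormal y).toMonoidHom) hb
    simpa using this

theorem pow_eq_one_of_mem_center (h : IsSchmidt p q n P y) {c : G} (hc : c ∈ P)
    (hcz : c ∈ center G) : c ^ p = 1 := by
  let R : Subgroup G :=
    { carrier := {c | c ∈ center G ∧ c ^ p = 1}
      one_mem' := ⟨one_mem _, one_pow p⟩
      mul_mem' := fun {a b} ha hb => ⟨mul_mem ha.1 hb.1, by
        rw [Commute.mul_pow (mem_center_iff.1 ha.1 b).symm, ha.2, hb.2, one_mul]⟩
      inv_mem' := fun {a} ha => ⟨inv_mem ha.1, by rw [inv_pow, ha.2, inv_one]⟩ }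
  have hle : ⁅P, P⁆ ≤ R := by
    refine commutator_le.2 fun a ha b hb => ?_
    have hd := commutator_mem_commutator ha hb
    have hdz := h.mem_center (h.commutator_lt.le hd) (h.commute_of_mem_commutator hd)
    refine ⟨hdz, ?_⟩
    have h1 : a * b * a⁻¹ = ⁅a, b⁆ * b := by simp [commutatorElement_def]
    have h2 := congrArg (· ^ p) h1
    have hcomm : Commute ⁅a, b⁆ b := (mem_center_iff.1 hdz b).symm
    simp only [conj_pow, hcomm.mul_pow] at h2
    rw [mem_center_iff.1 (h.pow_mem_center hb) a] at h2
    simpa using h2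
  exact (hle (h.mem_commutator hc hcz)).2

end IsSchmidt

theorem phi_congr {G H : Type*} [Group G] [Group H] (e : G ≃* H) : phi G = phi H :=
  Nat.card_congr <| e.toEquiv.subtypeEquiv fun a => by
    rw [Monoid.exponent_eq_of_mulEquiv e]
    exact (MulEquiv.orderOf_eq e a).symm ▸ Iff.rfl

theorem phi_prod {A B : Type*} [Group A] [Group B] [Finite A] [Finite B]
    (h : (Monoid.exponent A).Coprime (Monoid.exponent B)) : phi (A × B) = phi A * phi B := by
  rw [phi, phi, phi, ← Nat.card_prod]
  refine Nat.card_congr ((Equiv.subtypeEquivRight fun x => ?_).trans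
    (Equiv.subtypeProdEquivProd (p := fun a : A => orderOf a = Monoid.exponent A)
      (q := fun b : B => orderOf b = Monoid.exponent B)))
  have h1 := Monoid.order_dvd_exponent x.1
  have h2 := Monoid.order_dvd_exponent x.2
  rw [Prod.orderOf, Monoid.exponent_prod]
  change (orderOf x.1).lcm (orderOf x.2) = (Monoid.exponent A).lcm (Monoid.exponent B) ↔ _
  rw [h.lcm_eq_mul, (Nat.Coprime.of_dvd h1 h2 h).lcm_eq_mul]
  refine ⟨fun he => ⟨?_, ?_⟩, fun he => by rw [he.1, he.2]⟩
  · refine Nat.dvd_antisymm h1 ((h.coprime_dvd_right h2).dvd_of_dvd_mul_right ?_)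
    exact he ▸ dvd_mul_right _ _
  · refine Nat.dvd_antisymm h2 ((h.coprime_dvd_left h1).symm.dvd_of_dvd_mul_left ?_)
    exact he ▸ dvd_mul_left _ _

theorem phi_of_exponent_prime {G : Type*} [Group G] [Finite G] {p : ℕ} (hp : p.Prime)
    (h : Monoid.exponent G = p) : phi G = Nat.card G - 1 := by
  rw [← card_ne_one_add_one G, Nat.add_sub_cancel, phi]
  refine Nat.card_congr (Equiv.subtypeEquivRight fun a => ?_)
  have := Fact.mk hp
  rw [h, orderOf_eq_prime_iff]
  exact and_iff_right (h ▸ Monoid.pow_exponent_eq_one a)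

theorem phi_of_isCyclic {G : Type*} [Group G] [Finite G] [IsCyclic G] :
    phi G = (Nat.card G).totient := by
  rw [phi, IsCyclic.exponent_eq_card]
  have := Fintype.ofFinite G
  classical
  rw [Nat.card_eq_fintype_card, Fintype.card_subtype, Nat.card_eq_fintype_card,
    IsCyclic.card_orderOf_eq_totient dvd_rfl]

namespace IsSchmidt

variable {G : Type*} [Group G] [Finite G] {p q n : ℕ} {P : Subgroup G} {y : G}

theorem exponent_dvd (h : IsSchmidt p q n P y) (hphi : phi G ≠ 0) :
    Monoid.exponent G ∣ p * q ^ n := by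
  obtain ⟨k, hk⟩ := (have := Fact.mk h.prime_p; IsPGroup.iff_card.1 h.isPGroup)
  have := h.normal
  obtain ⟨⟨g, hg⟩⟩ : Nonempty {a : G // orderOf a = Monoid.exponent G} :=
    (Nat.card_ne_zero.1 hphi).1
  obtain ⟨m, hm⟩ := h.orderOf_eq ▸ Monoid.order_dvd_exponent y
  have hmk : q ^ n * m ∣ q ^ n * p ^ k := by
    rw [← hm, ← hg, mul_comm (q ^ n), ← hk, h.card_mul]
    exact orderOf_dvd_natCard g
  obtain ⟨a, -, rfl⟩ := (Nat.dvd_prime_pow h.prime_p).1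
    (Nat.dvd_of_mul_dvd_mul_left (pow_pos h.prime_q.pos n) hmk)
  have hu : orderOf (g ^ p ^ a) = q ^ n := by
    have hpos := pow_pos h.prime_p.pos a
    rw [orderOf_pow_of_dvd hpos.ne' (by rw [hg, hm]; exact dvd_mul_left _ _), hg, hm,
      Nat.mul_div_cancel _ hpos]
  have hgP : g ^ q ^ n ∈ P := h.index_eq ▸ P.pow_index_mem g
  have hc := (h.of_orderOf_eq hu).mem_center hgP (Commute.pow_pow_self g _ _)
  have := h.pow_eq_one_of_mem_center hgP hc
  rw [← hg, mul_comm]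
  exact orderOf_dvd_of_pow_eq_one (by rw [pow_mul, this])

theorem exponent_eq_prime (h : IsSchmidt p q n P y) (hphi : phi G ≠ 0) :
    Monoid.exponent P = p := by
  have : Monoid.exponent P ∣ p := Monoid.exponent_dvd_of_forall_pow_eq_one fun ⟨x, hx⟩ => by
    rw [Subtype.ext_iff, coe_pow, coe_one]
    obtain ⟨i, hi⟩ := h.isPGroup.exists_pow_eq_one (P.pow_mem hx p)
    refine eq_one_of_pow_eq_one_of_coprime (h.coprime_pow i n) hi ?_
    rw [← pow_mul]
    exact orderOf_dvd_iff_pow_eq_one.1 ((Monoid.order_dvd_exponent x).trans (h.exponent_dvd hphi))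
  refine (h.prime_p.eq_one_or_self_of_dvd _ this).resolve_left fun h1 => h.ne_bot ?_
  have := Monoid.exp_eq_one_iff.1 h1
  exact P.eq_bot_of_subsingleton

theorem exponent_eq (h : IsSchmidt p q n P y) (hphi : phi G ≠ 0) :
    Monoid.exponent G = p * q ^ n := by
  refine Nat.dvd_antisymm (h.exponent_dvd hphi) ?_
  have hcop := h.coprime_pow 1 n
  rw [pow_one] at hcop
  refine hcop.mul_dvd_of_dvd_of_dvd ?_ (h.orderOf_eq ▸ Monoid.order_dvd_exponent y)
  rw [← h.exponent_eq_prime hphi]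
  exact Monoid.exponent_dvd_of_monoidHom P.subtype P.subtype_injective

/-- The elements of order divisible by `q ^ n` have order `q ^ n` or the exponent of `G`. -/
theorem card_dvd_orderOf (h : IsSchmidt p q n P y) (hphi : phi G ≠ 0) :
    Nat.card {g : G // q ^ n ∣ orderOf g} = Nat.card {g : G // orderOf g = q ^ n} + phi G := by
  classical
  rw [phi, ← Nat.card_sum]
  refine Nat.card_congr ((Equiv.subtypeEquivRight fun g => ?_).trans
    (subtypeOrEquiv _ _ ?_))
  · rw [h.exponent_eq hphi]
    refine ⟨fun ⟨m, hm⟩ => ?_, ?_⟩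
    · have := (Monoid.order_dvd_exponent g).trans (h.exponent_dvd hphi)
      rw [hm, mul_comm p] at this
      have := Nat.dvd_of_mul_dvd_mul_left (pow_pos h.prime_q.pos n) this
      rcases h.prime_p.eq_one_or_self_of_dvd _ this with rfl | rfl
      · exact Or.inl (by rw [hm, mul_one])
      · exact Or.inr (by rw [hm, mul_comm])
    · rintro (hg | hg) <;> rw [hg]
      exact dvd_mul_left _ _
  · rw [Pi.disjoint_iff]
    intro g
    rw [Prop.disjoint_iff]
    by_contra! hg
    have := hg.1.symm.trans hg.2
    rw [h.exponent_eq hphi, eq_comm, Nat.mul_eq_right (pow_pos h.prime_q.pos n).ne'] at this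
    exact h.prime_p.ne_one this

theorem card_dvd_orderOf_eq_mul_totient (h : IsSchmidt p q n P y) :
    Nat.card {g : G // q ^ n ∣ orderOf g} = Nat.card P * (q ^ n).totient := by
  have := h.normal
  have hcard : Nat.card (zpowers y) = q ^ n := by rw [Nat.card_zpowers, h.orderOf_eq]
  have hZ : Nat.card {v : zpowers y // orderOf v = q ^ n} = (q ^ n).totient := by
    have := phi_of_isCyclic (G := zpowers y)
    rwa [phi, IsCyclic.exponent_eq_card, hcard] at this
  have hiff : ∀ x : zpowers y × P, orderOf x.1 = q ^ n ↔ q ^ n ∣ orderOf (x.1 * x.2 : G) := by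
    rintro ⟨⟨v, hv⟩, ⟨x, hx⟩⟩
    have hmem : ∀ m : ℕ, (v * x) ^ m ∈ P ↔ v ^ m = 1 := fun m => by
      have h1 : (v * x) ^ m ∈ P ↔ v ^ m ∈ P := by
        rw [← QuotientGroup.eq_one_iff, ← QuotientGroup.eq_one_iff]
        simp [(QuotientGroup.eq_one_iff x).2 hx]
      refine h1.trans ⟨fun hm => ?_, fun hm => hm ▸ P.one_mem⟩
      exact disjoint_def.1 h.isComplement'.disjoint hm ((zpowers y).pow_mem hv m)
    simp only [orderOf_mk]
    constructor
    · intro hd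
      rw [← hd]
      exact orderOf_dvd_of_pow_eq_one ((hmem _).1 (pow_orderOf_eq_one (v * x) ▸ P.one_mem))
    · intro hd
      refine Nat.dvd_antisymm (hcard ▸ orderOf_dvd_natCard _ hv) ?_
      obtain ⟨i, hi⟩ := h.isPGroup.exists_pow_eq_one ((hmem _).2 (pow_orderOf_eq_one v))
      rw [← pow_mul] at hi
      exact (h.coprime_pow i n).symm.dvd_of_dvd_mul_right (hd.trans (orderOf_dvd_of_pow_eq_one hi))
  rw [← hZ, mul_comm, ← Nat.card_prod]
  refine Nat.card_congr (Equiv.trans (Equiv.symm ?_) (Equiv.prodSubtypeFstEquivSubtypeProd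
    (p := fun v : zpowers y => orderOf v = q ^ n)))
  exact (Equiv.ofBijective _ h.isComplement'.symm).subtypeEquiv hiff

theorem card_dvd_orderOf_eq_card_mul (h : IsSchmidt p q n P y) (hphi : phi G ≠ 0) :
    Nat.card {g : G // q ^ n ∣ orderOf g} =
      Nat.card (P ⊓ center G : Subgroup G) * Nat.card {g : G // orderOf g = q ^ n} := by
  have := h.normal
  have hcop := h.coprime_pow 1 n
  rw [pow_one] at hcop
  rw [← Nat.card_prod, eq_comm]
  have hcomm : ∀ c : (P ⊓ center G : Subgroup G), ∀ g, Commute (c : G) g := fun c g =>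
    (mem_center_iff.1 c.2.2 g).symm
  have hpow : ∀ c : (P ⊓ center G : Subgroup G), (c : G) ^ p = 1 := fun c =>
    h.pow_eq_one_of_mem_center c.2.1 c.2.2
  refine Nat.card_congr (Equiv.ofBijective (fun x => ⟨x.1 * x.2, ?_⟩) ⟨?_, ?_⟩)
  · rw [(hcomm _ _).orderOf_mul_eq_mul_orderOf_of_coprime, x.2.2]
    · exact dvd_mul_left _ _
    · rw [x.2.2]
      exact hcop.coprime_dvd_left (orderOf_dvd_of_pow_eq_one (hpow _))
  · rintro ⟨c, u, hu⟩ ⟨c', u', hu'⟩ he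
    replace he : (c : G) * u = c' * u' := congrArg Subtype.val he
    have h1 : ((c : G) * (c' : G)⁻¹) ^ q ^ n = 1 := by
      have := congrArg (· ^ q ^ n) he
      simp only [(hcomm _ _).mul_pow, ← hu] at this
      rw [hu, ← hu', pow_orderOf_eq_one, hu', ← hu, pow_orderOf_eq_one, mul_one, mul_one, hu] at this
      rw [(hcomm _ _).mul_pow, inv_pow, this, mul_inv_cancel]
    have h2 : ((c : G) * (c' : G)⁻¹) ^ p = 1 := by
      rw [(hcomm _ _).mul_pow, inv_pow, hpow, hpow, inv_one, one_mul]
    have h3 := mul_inv_eq_one.1 (eq_one_of_pow_eq_one_of_coprime hcop h2 h1)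
    rw [h3] at he
    simp only [Prod.mk.injEq, Subtype.mk.injEq]
    exact ⟨Subtype.ext h3, mul_left_cancel he⟩
  · rintro ⟨g, hg⟩
    have hgp : g ^ (p * q ^ n) = 1 :=
      orderOf_dvd_iff_pow_eq_one.1 ((Monoid.order_dvd_exponent g).trans (h.exponent_dvd hphi))
    have hbez := Nat.gcd_eq_gcd_ab p (q ^ n)
    rw [Nat.Coprime.gcd_eq_one hcop] at hbez
    set c := (g ^ q ^ n) ^ p.gcdB (q ^ n) with hc
    set u := (g ^ p) ^ p.gcdA (q ^ n) with hu
    have hcp : c ^ p = 1 := by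
      rw [hc, ← zpow_natCast, zpow_comm, zpow_natCast, ← pow_mul, mul_comm, hgp, one_zpow]
    have huq : u ^ q ^ n = 1 := by
      rw [hu, ← zpow_natCast, zpow_comm, zpow_natCast, ← pow_mul, hgp, one_zpow]
    have hcu : c * u = g := by
      rw [hc, hu, ← zpow_natCast, ← zpow_natCast, ← zpow_mul, ← zpow_mul, ← zpow_add, add_comm,
        ← hbez]
      simp
    have hcomm : Commute c u := ((Commute.pow_pow_self g _ _).zpow_left _).zpow_right _
    have hou : orderOf u = q ^ n := by
      refine Nat.dvd_antisymm (orderOf_dvd_of_pow_eq_one huq) ?_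
      refine (hcop.symm.coprime_dvd_right (orderOf_dvd_of_pow_eq_one hcp)).dvd_of_dvd_mul_left ?_
      exact (hcu ▸ hg).trans hcomm.orderOf_mul_dvd_mul_orderOf
    have hcP : c ∈ P := P.zpow_mem (h.index_eq ▸ P.pow_index_mem g) _
    exact ⟨⟨⟨c, hcP, (h.of_orderOf_eq hou).mem_center hcP hcomm⟩, ⟨u, hou⟩⟩, Subtype.ext hcu⟩

theorem exists_phi_eq (h : IsSchmidt p q n P y) (hphi : phi G ≠ 0) :
    ∃ M : Subgroup G, phi M = (Nat.card P - 1) * (q ^ (n - 1)).totient := by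
  have hord : orderOf (y ^ q) = q ^ (n - 1) := by
    rw [orderOf_pow_of_dvd h.prime_q.ne_zero (h.orderOf_eq ▸ dvd_pow_self q h.pos.ne'),
      h.orderOf_eq, ← Nat.pow_div h.pos h.prime_q.pos, pow_one]
  have hcomm : ∀ (a : P) (b : zpowers (y ^ q)),
      Commute (P.subtype a) ((zpowers (y ^ q)).subtype b) := fun a b =>
    mem_center_iff.1 ((zpowers_le.2 h.pow_q_mem_center) b.2) a
  have hinj : Function.Injective
      (MonoidHom.noncommCoprod P.subtype (zpowers (y ^ q)).subtype hcomm) := by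
    rw [MonoidHom.noncommCoprod_injective]
    refine ⟨subtype_injective _, subtype_injective _, ?_⟩
    rw [range_subtype, range_subtype]
    exact h.isComplement'.disjoint.mono_right (zpowers_le.2 (npow_mem_zpowers y q))
  refine ⟨_, (phi_congr (MonoidHom.ofInjective hinj)).symm.trans ?_⟩
  rw [phi_prod, phi_of_exponent_prime h.prime_p (h.exponent_eq_prime hphi), phi_of_isCyclic,
    Nat.card_zpowers, hord]
  rw [h.exponent_eq_prime hphi, IsCyclic.exponent_eq_card, Nat.card_zpowers, hord]
  simpa using h.coprime_pow 1 (n - 1)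

theorem card_modEq_card (h : IsSchmidt p q n P y) :
    Nat.card P ≡ Nat.card (P ⊓ center G : Subgroup G) [MOD q] := by
  have := h.normal
  have := Fact.mk h.prime_q
  let _ : MulAction (zpowers y) P :=
    MulAction.compHom P ((MulAut.conjNormal (H := P)).comp (zpowers y).subtype)
  have hsmul : ∀ (v : zpowers y) (x : P), ((v • x : P) : G) = v * x * (v : G)⁻¹ := fun v x =>
    MulAut.conjNormal_apply (v : G) x
  have hcard : Nat.card (MulAction.fixedPoints (zpowers y) P) =
      Nat.card (P ⊓ center G : Subgroup G) := ?_
  · exact hcard ▸ (isPGroup_zpowers h.pow_eq_one).card_modEq_card_fixedPoints P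
  refine Nat.card_congr ((Equiv.subtypeSubtypeEquivSubtypeInter (· ∈ P) (· ∈ center G)).symm.trans
    (Equiv.subtypeEquivRight fun x => ?_)).symm
  rw [MulAction.mem_fixedPoints]
  refine ⟨fun hx v => Subtype.ext ?_, fun hx => h.mem_center x.2 ?_⟩
  · rw [hsmul, mem_center_iff.1 hx]
    simp
  · have := congrArg Subtype.val (hx ⟨y, mem_zpowers y⟩)
    rw [hsmul, mul_inv_eq_iff_eq_mul] at this
    exact this.symm

/-- The center of `G` meets `P` in a subgroup of index larger than `q`. -/
theorem exists_card_eq_mul (h : IsSchmidt p q n P y) :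
    ∃ d, q < d ∧ Nat.card P = Nat.card (P ⊓ center G : Subgroup G) * d := by
  obtain ⟨d, hd⟩ := card_dvd_of_le (inf_le_left : P ⊓ center G ≤ P)
  refine ⟨d, ?_, hd⟩
  obtain ⟨k, hk⟩ := (have := Fact.mk h.prime_p; IsPGroup.iff_card.1 h.isPGroup)
  have hcop : q.gcd (Nat.card (P ⊓ center G : Subgroup G)) = 1 := by
    have := (h.coprime_pow k 1).symm
    rw [pow_one, ← hk] at this
    exact this.coprime_dvd_right (card_dvd_of_le inf_le_left)
  have hmod := h.card_modEq_card
  rw [hd] at hmod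
  have hmod' : d ≡ 1 [MOD q] :=
    Nat.ModEq.cancel_left_of_coprime hcop (by rwa [mul_one])
  have hd0 : d ≠ 0 := by
    rintro rfl
    exact Nat.card_pos.ne' (hd.trans (mul_zero _))
  have hd1 : d ≠ 1 := by
    rintro rfl
    rw [mul_one] at hd
    have := eq_of_le_of_card_ge (inf_le_left : P ⊓ center G ≤ P) hd.le
    obtain ⟨x, hx, hxy⟩ := h.exists_not_commute
    exact hxy (mem_center_iff.1 (inf_eq_left.1 this hx) y).symm
  have := Nat.le_of_dvd (by omega) ((Nat.modEq_iff_dvd' (by omega)).1 hmod'.symm)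
  omega

end IsSchmidt

theorem exists_totient_prime_pow_eq_mul {q n : ℕ} (hq : q.Prime) (hn : 0 < n) :
    ∃ t, 0 < t ∧ t ≤ q ∧ (q ^ n).totient = t * (q ^ (n - 1)).totient := by
  obtain ⟨m, rfl⟩ := Nat.exists_eq_succ_of_ne_zero hn.ne'
  have := hq.two_le
  rw [Nat.succ_sub_one, Nat.totient_prime_pow_succ hq]
  cases m with
  | zero => exact ⟨q - 1, by omega, by omega, by simp⟩
  | succ m => exact ⟨q, by omega, le_rfl, by rw [Nat.totient_prime_pow_succ hq]; ring⟩

/-- The counting argument: `c`, `d`, `t` play the roles of `|P ∩ Z(G)|`, `|P : P ∩ Z(G)|` and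
`φ(q ^ n) / φ(q ^ (n - 1))`. -/
theorem not_mul_sub_one_dvd {c d t : ℕ} (hc : 1 < c) (hd : 1 < d) (ht : 0 < t) (htd : t ≤ d) :
    ¬ c * d - 1 ∣ (c - 1) * (d * t) := by
  intro h
  have hcd : c * d - 1 + 1 = c * d := Nat.sub_add_cancel (Nat.mul_pos (by omega) (by omega))
  have hcop : (c * d - 1).Coprime d := by
    have : (c * d - 1).Coprime (c * d - 1 + 1) := by simp
    exact this.coprime_dvd_right (hcd ▸ dvd_mul_left d c)
  rw [mul_left_comm] at h
  have h1 := Nat.le_of_dvd (Nat.mul_pos (by omega) ht) (hcop.dvd_of_dvd_mul_left h)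
  have h2 := Nat.mul_le_mul_left (c - 1) htd
  rw [Nat.sub_one_mul c d] at h2
  have h3 := Nat.le_mul_of_pos_left d (by omega : 0 < c)
  omega

theorem stmt_13 :
    ∀ (G : Type) [Group G] [Finite G],
      ¬ Group.IsNilpotent G →
      (∀ H : Subgroup G, H ≠ ⊤ → Group.IsNilpotent H) →
      (∀ S : Subgroup G, phi S ≠ 0) →
      (∀ H K : Subgroup G, H ≤ K → phi H ∣ phi K) → False := by
  intro G _ _ hnil hprop hne hdvd
  obtain ⟨p, q, n, P, y, hp, hq, hpq, hP, hPp, hy, htop⟩ :=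
    exists_sylow_of_minimal_nonnilpotent hnil hprop
  have h : IsSchmidt p q n P y := ⟨hp, hq, hpq, hP, hPp, hy, htop, hnil, hprop⟩
  have htopG := phi_congr (Subgroup.topEquiv (G := G))
  have hphi : phi G ≠ 0 := htopG ▸ hne ⊤
  obtain ⟨M, hM⟩ := h.exists_phi_eq hphi
  have hdiv := hdvd M ⊤ le_top
  obtain ⟨d, hqd, hd⟩ := h.exists_card_eq_mul
  obtain ⟨t, ht, htq, htot⟩ := exists_totient_prime_pow_eq_mul hq h.pos
  have h1 := h.card_dvd_orderOf hphi
  have h2 := h.card_dvd_orderOf_eq_mul_totient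
  have h3 := h.card_dvd_orderOf_eq_card_mul hphi
  rw [h3] at h1 h2
  rw [htopG, hM, hd] at hdiv
  rw [hd, mul_assoc] at h2
  have hc : 0 < Nat.card (P ⊓ center G : Subgroup G) := Nat.card_pos
  generalize Nat.card (P ⊓ center G : Subgroup G) = c at *
  rw [Nat.eq_of_mul_eq_mul_left hc h2, htot] at h1
  have h4 : phi G = (c - 1) * (d * t) * (q ^ (n - 1)).totient := by
    rw [eq_comm, ← Nat.sub_eq_of_eq_add' h1, ← Nat.sub_one_mul]
    ring
  rw [h4] at hdiv
  have hc1 : 1 < c := by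
    by_contra hc1
    obtain rfl : c = 1 := by omega
    simp [h4] at hphi
  exact not_mul_sub_one_dvd hc1 (hq.one_lt.trans hqd) ht (htq.trans hqd.le)
    (Nat.dvd_of_mul_dvd_mul_right (Nat.totient_pos.2 (pow_pos hq.pos _)) hdiv)
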